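/- arXiv:math/0506207 — 3 statements merged into one kernel-verified Lean document; each statement's English description precedes it below -/
import Mathlib

section
/- For every complex number z with Re z > 1, the alternating Kurepa function satisfies A(z+1) − z·A(z) − (z+1)·A(z−1) = 0. -/
open MeasureTheory

/-- The alternating Kurepa function, defined for `Re z > 0` by
`A(z) = ∫₀^∞ e^{−t} (t^{z+1} − e^{iπz} t)/(t+1) dt`, where `(−1)^z` is taken as the
principal value `e^{iπz}`. -/
noncomputable def altKurepa (z : ℂ) : ℂ :=
  ∫ t in Set.Ioi (0 : ℝ),
    (Real.exp (-t) : ℂ) * ((t : ℂ) ^ (z + 1) -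
      Complex.exp ((Real.pi : ℂ) * Complex.I * z) * (t : ℂ)) / ((t : ℂ) + 1)

/-- The integrand defining `altKurepa z` is integrable on `(0, ∞)`. -/
theorem integrableOn_altKurepa_integrand {z : ℂ} (hz : 0 < z.re) :
    IntegrableOn (fun t : ℝ => (Real.exp (-t) : ℂ) * ((t : ℂ) ^ (z + 1) -
      Complex.exp ((Real.pi : ℂ) * Complex.I * z) * (t : ℂ)) / ((t : ℂ) + 1))
      (Set.Ioi 0) := by
  have h₁ := Complex.GammaIntegral_convergent (s := z + 2) (by simp; linarith)
  have h₂ := (Complex.GammaIntegral_convergent (s := 2) (by simp)).const_mul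
    (Complex.exp ((Real.pi : ℂ) * Complex.I * z))
  have hbound : ∀ᵐ t : ℝ ∂volume.restrict (Set.Ioi 0), ‖((t : ℂ) + 1)⁻¹‖ ≤ 1 := by
    filter_upwards [ae_restrict_mem measurableSet_Ioi] with t (ht : 0 < t)
    rw [norm_inv, ← Complex.ofReal_one, ← Complex.ofReal_add, Complex.norm_real]
    refine inv_le_one_of_one_le₀ ?_
    rw [Real.norm_of_nonneg (by linarith)]
    linarith
  have hmeas : Measurable fun t : ℝ => ((t : ℂ) + 1)⁻¹ :=
    (Complex.measurable_ofReal.add_const 1).inv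
  refine ((h₁.sub h₂).mul_bdd (c := 1) hmeas.aestronglyMeasurable hbound).congr ?_
  filter_upwards with t
  have e₁ : z + 2 - 1 = z + 1 := by ring
  have e₂ : (2 : ℂ) - 1 = 1 := by norm_num
  simp only [Pi.sub_apply, e₁, e₂, Complex.cpow_one]
  ring

theorem altKurepa_add_one_add {z : ℂ} (hz : 0 < z.re) :
    altKurepa (z + 1) + altKurepa z = Complex.Gamma (z + 2) := by
  rw [Complex.Gamma_eq_integral (by simp; linarith), Complex.GammaIntegral, altKurepa, altKurepa,
    ← integral_add (integrableOn_altKurepa_integrand (by simp; linarith))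
      (integrableOn_altKurepa_integrand hz)]
  refine setIntegral_congr_fun measurableSet_Ioi fun t (ht : 0 < t) => ?_
  have ht₀ : (t : ℂ) ≠ 0 := by exact_mod_cast ht.ne'
  have ht₁ : (t : ℂ) + 1 ≠ 0 := by exact_mod_cast (by linarith : t + 1 ≠ 0)
  have hpow : (t : ℂ) ^ (z + 1 + 1) = t ^ (z + 1) * t := by
    rw [Complex.cpow_add _ _ ht₀, Complex.cpow_one]
  have hexp : Complex.exp ((Real.pi : ℂ) * Complex.I * (z + 1)) =
      -Complex.exp ((Real.pi : ℂ) * Complex.I * z) := by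
    rw [mul_add, Complex.exp_add, mul_one, Complex.exp_pi_mul_I, mul_neg_one]
  have e₁ : z + 2 - 1 = z + 1 := by ring
  simp only [hpow, hexp, e₁]
  field_simp
  ring

/-- For every complex `z` with `Re z > 1`, the alternating Kurepa function satisfies
`A(z+1) − z·A(z) − (z+1)·A(z−1) = 0`. -/
theorem altKurepa_three_term_recurrence (z : ℂ) (hz : 1 < z.re) :
    altKurepa (z + 1) - z * altKurepa z - (z + 1) * altKurepa (z - 1) = 0 := by
  have h₁ := altKurepa_add_one_add (z := z) (by linarith)
  have h₂ := altKurepa_add_one_add (z := z - 1) (by simp; linarith)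
  have hz₀ : z + 1 ≠ 0 := fun h => by
    have := congrArg Complex.re h
    simp at this
    linarith
  have hΓ := Complex.Gamma_add_one (z + 1) hz₀
  rw [sub_add_cancel, show z - 1 + 2 = z + 1 by ring] at h₂
  rw [show z + 1 + 1 = z + 2 by ring] at hΓ
  linear_combination h₁ - (z + 1) * h₂ + hΓ
end

section
/- For each natural number n ≥ 1 and every complex number z with Re z > n, it holds that A(z) = (−1)ⁿ·( A(z − n) + rₙ(z)·Γ(z+2) ). -/
open MeasureTheory

/-- The rational functions `rₙ`: `r₁(z) = −1/(z+1)`, `r₂(z) = (z−1)/(z(z+1))`, and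
`rₙ(z) = −((z−n+1)/(z−n+2))·rₙ₋₁(z) + (1/(z−n+2))·rₙ₋₂(z)` for `n ≥ 3`.
(The value of `r₀` is an irrelevant junk value.) -/
noncomputable def kurepaR : ℕ → ℂ → ℂ
  | 0, _ => 0
  | 1, z => -1 / (z + 1)
  | 2, z => (z - 1) / (z * (z + 1))
  | (n + 3), z =>
      -((z - ((n : ℂ) + 3) + 1) / (z - ((n : ℂ) + 3) + 2)) * kurepaR (n + 2) z +
        (1 / (z - ((n : ℂ) + 3) + 2)) * kurepaR (n + 1) z

lemma integrableOn_altKurepa_rpow {s : ℂ} (hs : 0 < s.re) :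
    IntegrableOn (fun t : ℝ => (Real.exp (-t) : ℂ) * (t : ℂ) ^ (s - 1) / ((t : ℂ) + 1))
      (Set.Ioi 0) := by
  have h := Complex.GammaIntegral_convergent hs
  refine Integrable.mono h ?_ ?_
  · refine h.aestronglyMeasurable.mul (g := fun t : ℝ => ((t : ℂ) + 1)⁻¹) ?_
    exact Measurable.aestronglyMeasurable (by fun_prop)
  · filter_upwards [ae_restrict_mem measurableSet_Ioi] with t ht
    have ht : 0 < t := ht
    rw [norm_div]
    have h1 : 1 ≤ ‖(t : ℂ) + 1‖ := by
      have : (t : ℂ) + 1 = ((t + 1 : ℝ) : ℂ) := by push_cast; rfl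
      rw [this, Complex.norm_real, Real.norm_of_nonneg (by linarith)]
      linarith
    exact div_le_self (norm_nonneg _) h1

lemma integrableOn_altKurepa {z : ℂ} (hz : -2 < z.re) :
    IntegrableOn (fun t : ℝ => (Real.exp (-t) : ℂ) * ((t : ℂ) ^ (z + 1) -
      Complex.exp ((Real.pi : ℂ) * Complex.I * z) * (t : ℂ)) / ((t : ℂ) + 1)) (Set.Ioi 0) := by
  have h1 := integrableOn_altKurepa_rpow (s := z + 2) (by simp; linarith)
  have h2 := (integrableOn_altKurepa_rpow (s := 2) (by simp)).const_mul
    (Complex.exp ((Real.pi : ℂ) * Complex.I * z))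
  refine (h1.sub h2).congr (Filter.Eventually.of_forall fun t => ?_)
  have e1 : z + 2 - 1 = z + 1 := by ring
  have e2 : (2 : ℂ) - 1 = 1 := by norm_num
  simp only [Pi.sub_apply, e1, e2, Complex.cpow_one]
  ring

/-- The functional equation `A(z) + A(z - 1) = Γ(z + 1)`. -/
lemma altKurepa_add_altKurepa_sub_one {z : ℂ} (hz : -1 < z.re) :
    altKurepa z + altKurepa (z - 1) = Complex.Gamma (z + 1) := by
  rw [altKurepa, altKurepa, ← integral_add (integrableOn_altKurepa (by linarith))
    (integrableOn_altKurepa (by simp; linarith)), Complex.Gamma_eq_integral (by simp; linarith),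
    Complex.GammaIntegral]
  refine setIntegral_congr_fun measurableSet_Ioi fun t ht => ?_
  have ht : 0 < t := ht
  have h0 : (t : ℂ) ≠ 0 := by exact_mod_cast ht.ne'
  have h1 : (t : ℂ) + 1 ≠ 0 := by exact_mod_cast (by linarith : t + 1 ≠ 0)
  have he : Complex.exp ((Real.pi : ℂ) * Complex.I * (z - 1)) =
      -Complex.exp ((Real.pi : ℂ) * Complex.I * z) := by
    rw [mul_sub, mul_one, Complex.exp_sub, Complex.exp_pi_mul_I, div_neg, div_one]
  simp only [he, sub_add_cancel, add_sub_cancel_right, Complex.cpow_add _ _ h0, Complex.cpow_one]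
  field_simp
  ring

lemma kurepaR_succ_add_kurepaR (n : ℕ) {z : ℂ} (hz : (n : ℝ) < z.re) :
    (kurepaR (n + 2) z + kurepaR (n + 1) z) * Complex.Gamma (z + 2) =
      -Complex.Gamma (z - n) := by
  induction n with
  | zero =>
    have hz : 0 < z.re := by simpa using hz
    have h0 : z ≠ 0 := by rintro rfl; simp at hz
    have h1 : z + 1 ≠ 0 := by
      intro h
      have := congrArg Complex.re h
      simp at this
      linarith
    have e : z + 2 = z + 1 + 1 := by ring
    rw [e, Complex.Gamma_add_one _ h1, Complex.Gamma_add_one _ h0]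
    simp only [kurepaR, Nat.cast_zero, sub_zero]
    field_simp
    ring
  | succ n ih =>
    push_cast at hz ⊢
    have hw : z - (n + 1) ≠ 0 := by
      intro h
      have := congrArg Complex.re h
      simp at this
      linarith
    have hr : kurepaR (n + 3) z + kurepaR (n + 2) z =
        (kurepaR (n + 2) z + kurepaR (n + 1) z) / (z - (n + 1)) := by
      have e1 : z - ((n : ℂ) + 3) + 1 = z - (n + 1) - 1 := by ring
      have e2 : z - ((n : ℂ) + 3) + 2 = z - (n + 1) := by ring
      rw [kurepaR, e1, e2]
      field_simp
      ring
    have e : z - (n : ℂ) = z - (n + 1) + 1 := by ring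
    have ih := ih (by linarith)
    rw [e, Complex.Gamma_add_one _ hw] at ih
    rw [show n + 1 + 2 = n + 3 from rfl, show n + 1 + 1 = n + 2 from rfl, hr, div_mul_eq_mul_div,
      ih]
    field_simp

/-- For each `n ≥ 1` and every complex `z` with `Re z > n`,
`A(z) = (−1)ⁿ·( A(z − n) + rₙ(z)·Γ(z+2) )`. -/
theorem altKurepa_eq_shift_kurepaR (n : ℕ) (hn : 1 ≤ n) (z : ℂ) (hz : (n : ℝ) < z.re) :
    altKurepa z =
      (-1 : ℂ) ^ n * (altKurepa (z - (n : ℂ)) + kurepaR n z * Complex.Gamma (z + 2)) := by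
  induction n, hn using Nat.le_induction with
  | base =>
    have hz : 1 < z.re := by simpa using hz
    have h1 : z + 1 ≠ 0 := by
      intro h
      have := congrArg Complex.re h
      simp at this
      linarith
    have e : z + 2 = z + 1 + 1 := by ring
    have h := altKurepa_add_altKurepa_sub_one (z := z) (by linarith)
    rw [e, Complex.Gamma_add_one _ h1, ← h]
    simp only [kurepaR, Nat.cast_one]
    field_simp
    ring
  | succ n hn ih =>
    push_cast at hz ⊢
    obtain ⟨m, rfl⟩ := Nat.exists_eq_add_of_le' hn
    push_cast at hz ih ⊢
    have hA := altKurepa_add_altKurepa_sub_one (z := z - (m + 1)) (by simp; linarith)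
    have hR := kurepaR_succ_add_kurepaR m (z := z) (by linarith)
    have e1 : z - ((m : ℂ) + 1) - 1 = z - (m + 1 + 1) := by ring
    have e2 : z - ((m : ℂ) + 1) + 1 = z - m := by ring
    rw [e1, e2] at hA
    rw [ih (by linarith), show m + 1 + 1 = m + 2 from rfl, pow_succ]
    linear_combination (-1 : ℂ) ^ (m + 1) * (hA + hR)
end

section
/- The function F satisfies F(0) = 0, there exists a unique x₁ ∈ (−2, 0) with F(x₁) = 0, and moreover F(x) > 0 for all x ∈ (−2, x₁) ∪ (0, ∞) and F(x) < 0 for all x ∈ (x₁, 0). -/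
open MeasureTheory

/-- The real part of the alternating Kurepa function:
`F(x) = ∫₀^∞ e^{−t} (t^{x+1} − cos(πx)·t)/(t+1) dt`, convergent for `x > −2`. -/
noncomputable def reAltKurepa (x : ℝ) : ℝ :=
  ∫ t in Set.Ioi (0 : ℝ), Real.exp (-t) * (t ^ (x + 1) - Real.cos (Real.pi * x) * t) / (t + 1)

/-- The integral `∫₀^∞ e^{−t} t^{x+1}/(t+1) dt`, which is the non-oscillating part of
`reAltKurepa`. -/
noncomputable def altGamma (x : ℝ) : ℝ :=
  ∫ t in Set.Ioi (0 : ℝ), Real.exp (-t) * t ^ (x + 1) / (t + 1)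

theorem integrableOn_altGamma {x : ℝ} (hx : -2 < x) :
    IntegrableOn (fun t : ℝ => Real.exp (-t) * t ^ (x + 1) / (t + 1)) (Set.Ioi 0) := by
  have h := Real.GammaIntegral_convergent (s := x + 2) (by linarith)
  refine Integrable.mono' h ?_ ?_
  · refine ContinuousOn.aestronglyMeasurable (fun t (ht : 0 < t) => ?_) measurableSet_Ioi
    refine ContinuousAt.continuousWithinAt ?_
    have h1 : t + 1 ≠ 0 := by positivity
    have h2 : t ≠ 0 ∨ 0 ≤ x + 1 := Or.inl ht.ne'
    exact ((by fun_prop : ContinuousAt (fun t : ℝ => Real.exp (-t)) t).mul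
      (Real.continuousAt_rpow_const t _ h2)).div (by fun_prop) h1
  · filter_upwards [self_mem_ae_restrict measurableSet_Ioi] with t (ht : 0 < t)
    rw [Real.norm_of_nonneg (by positivity), mul_div_assoc,
      show x + 2 - 1 = x + 1 by ring]
    gcongr
    exact div_le_self (by positivity) (by linarith)

theorem integrableOn_altGamma_zero :
    IntegrableOn (fun t : ℝ => Real.exp (-t) * t / (t + 1)) (Set.Ioi 0) := by
  simpa using integrableOn_altGamma (x := 0) (by norm_num)

theorem altGamma_zero :
    altGamma 0 = ∫ t in Set.Ioi (0 : ℝ), Real.exp (-t) * t / (t + 1) := by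
  simp [altGamma]

theorem reAltKurepa_eq {x : ℝ} (hx : -2 < x) :
    reAltKurepa x = altGamma x - Real.cos (Real.pi * x) * altGamma 0 := by
  rw [altGamma_zero, altGamma, ← integral_const_mul, ← integral_sub
    (integrableOn_altGamma hx) (integrableOn_altGamma_zero.const_mul _), reAltKurepa]
  congr 1 with t
  ring

theorem altGamma_pos {x : ℝ} (hx : -2 < x) : 0 < altGamma x := by
  rw [altGamma, setIntegral_pos_iff_support_of_nonneg_ae _ (integrableOn_altGamma hx)]
  · have : Set.Ioi (0 : ℝ) ⊆
        Function.support (fun t : ℝ => Real.exp (-t) * t ^ (x + 1) / (t + 1)) := by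
      intro t (ht : 0 < t)
      have : 0 < Real.exp (-t) * t ^ (x + 1) / (t + 1) := by positivity
      exact this.ne'
    rw [Set.inter_eq_right.mpr this]
    simp
  · filter_upwards [self_mem_ae_restrict measurableSet_Ioi] with t (ht : 0 < t)
    simp only [Pi.zero_apply]
    positivity

theorem convexOn_altGamma : ConvexOn ℝ (Set.Ioi (-2)) altGamma := by
  refine ⟨convex_Ioi _, fun x hx y hy a b ha hb hab => ?_⟩
  have hz := (convex_Ioi (-2 : ℝ)) hx hy ha hb hab
  simp only [smul_eq_mul, Set.mem_Ioi] at *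
  rw [altGamma, altGamma, altGamma, ← integral_const_mul, ← integral_const_mul,
    ← integral_add ((integrableOn_altGamma hx).const_mul _)
      ((integrableOn_altGamma hy).const_mul _)]
  refine setIntegral_mono_on (integrableOn_altGamma hz)
    (((integrableOn_altGamma hx).const_mul _).add ((integrableOn_altGamma hy).const_mul _))
    measurableSet_Ioi fun t (ht : 0 < t) => ?_
  have h := Real.geom_mean_le_arith_mean2_weighted ha hb
    (Real.rpow_nonneg ht.le (x + 1)) (Real.rpow_nonneg ht.le (y + 1)) hab
  rw [← Real.rpow_mul ht.le, ← Real.rpow_mul ht.le, ← Real.rpow_add ht,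
    show (x + 1) * a + (y + 1) * b = a * x + b * y + 1 by linear_combination hab] at h
  calc Real.exp (-t) * t ^ (a * x + b * y + 1) / (t + 1)
      ≤ Real.exp (-t) * (a * t ^ (x + 1) + b * t ^ (y + 1)) / (t + 1) := by gcongr
    _ = _ := by ring

theorem integrableOn_exp_neg_mul : IntegrableOn (fun t : ℝ => Real.exp (-t) * t) (Set.Ioi 0) := by
  simpa [show (2 : ℝ) - 1 = 1 by norm_num] using
    Real.GammaIntegral_convergent (s := 2) (by norm_num)

theorem altGamma_zero_le_altGamma_neg_one : altGamma 0 ≤ altGamma (-1) := by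
  have e0 : IntegrableOn (fun t : ℝ => Real.exp (-t)) (Set.Ioi 0) := integrableOn_exp_neg_Ioi 0
  have i0 : ∫ t in Set.Ioi (0 : ℝ), Real.exp (-t) = 1 := integral_exp_neg_Ioi_zero
  have i1 : ∫ t in Set.Ioi (0 : ℝ), Real.exp (-t) * t = 1 := by
    have := Real.Gamma_eq_integral (s := 2) (by norm_num)
    simpa [show (2 : ℝ) - 1 = 1 by norm_num] using this.symm
  have hm := integrableOn_altGamma (x := -1) (by norm_num)
  have key : ∫ t in Set.Ioi (0 : ℝ), (Real.exp (-t) - Real.exp (-t) * t) ≤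
      ∫ t in Set.Ioi (0 : ℝ), 2 * (Real.exp (-t) * t ^ ((-1 : ℝ) + 1) / (t + 1)
        - Real.exp (-t) * t / (t + 1)) := by
    refine setIntegral_mono_on (e0.sub integrableOn_exp_neg_mul)
      ((hm.sub integrableOn_altGamma_zero).const_mul 2) measurableSet_Ioi
      fun t (ht : 0 < t) => ?_
    have h1 : t + 1 ≠ 0 := by positivity
    have : 2 * (Real.exp (-t) * t ^ ((-1 : ℝ) + 1) / (t + 1) - Real.exp (-t) * t / (t + 1)) -
        (Real.exp (-t) - Real.exp (-t) * t) = Real.exp (-t) * (1 - t) ^ 2 / (t + 1) := by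
      norm_num
      field_simp
      ring
    have : 0 ≤ Real.exp (-t) * (1 - t) ^ 2 / (t + 1) := by positivity
    linarith
  rw [integral_sub e0 integrableOn_exp_neg_mul, i0, i1, integral_const_mul,
    integral_sub hm integrableOn_altGamma_zero, ← altGamma_zero] at key
  change _ ≤ 2 * (altGamma (-1) - _) at key
  linarith

theorem altGamma_neg_one_add_altGamma_zero : altGamma (-1) + altGamma 0 = 1 := by
  have i0 : ∫ t in Set.Ioi (0 : ℝ), Real.exp (-t) = 1 := integral_exp_neg_Ioi_zero
  rw [altGamma_zero, altGamma, ← integral_add (integrableOn_altGamma (by norm_num))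
    integrableOn_altGamma_zero]
  refine Eq.trans ?_ i0
  refine setIntegral_congr_fun measurableSet_Ioi fun t (ht : 0 < t) => ?_
  have h1 : t + 1 ≠ 0 := by positivity
  norm_num
  field_simp
  ring

theorem exp_neg_div_le_quadratic {t : ℝ} (h0 : 0 ≤ t) (h1 : t ≤ 1) :
    Real.exp (-t) / (t + 1) ≤ 1 - 8 / 5 * t + 87 / 100 * t ^ 2 := by
  have he : 1 + t + t ^ 2 / 2 + t ^ 3 / 6 ≤ Real.exp t := by
    have := Real.sum_le_exp_of_nonneg h0 4
    simpa [Finset.sum_range_succ, Nat.factorial] using this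
  have hq : 0 < 1 - 8 / 5 * t + 87 / 100 * t ^ 2 := by nlinarith [sq_nonneg (t - 80 / 87)]
  rw [div_le_iff₀ (by positivity), Real.exp_neg, inv_le_iff_one_le_mul₀ (Real.exp_pos t)]
  refine le_trans ?_ (mul_le_mul_of_nonneg_left he (by positivity))
  have c3 : 0 ≤ (t - 3 / 5) ^ 2 * (t + 6 / 5) := by positivity
  have c4 : 0 ≤ (t - 3 / 5) ^ 2 * (t ^ 2 + 6 / 5 * t + 27 / 25) := by positivity
  have c5 : 0 ≤ (t - 3 / 5) ^ 2 * (t ^ 3 + 6 / 5 * t ^ 2 + 27 / 25 * t + 108 / 125) := by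
    positivity
  have hmain : 0 ≤ 2 / 5 - 83 / 100 * t + 1 / 150 * t ^ 2 + 81 / 200 * t ^ 3 + 47 / 150 * t ^ 4
      + 29 / 200 * t ^ 5 := by nlinarith
  linear_combination mul_nonneg h0 hmain

theorem linear_mul_le_log_bound {s : ℝ} (hs : 0 ≤ s) :
    s * (49 / 100 - 3 / 50 * s) ≤ (1 + s) / (2 + s) * (2 * s / (s + 2)) := by
  have h : (1 + s) / (2 + s) * (2 * s / (s + 2)) = s * ((2 + 2 * s) / (2 + s) ^ 2) := by
    field_simp
    ring
  rw [h]
  gcongr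
  rw [le_div_iff₀ (by positivity)]
  nlinarith [mul_nonneg hs (sq_nonneg (s - 25 / 12))]

theorem le_sub_rpow_of_one_le {h t : ℝ} (hh : 0 < h) (ht : 1 ≤ t) :
    h / (1 + 2 * h) * ((t - 1) * (49 / 100 - 3 / 50 * (t - 1))) ≤
      (t - t ^ (1 - h)) / (t + 1) := by
  obtain ⟨s, rfl⟩ : ∃ s, t = 1 + s := ⟨t - 1, by ring⟩
  have hs : 0 ≤ s := by linarith
  set L := 2 * s / (s + 2) with hL
  have hL0 : 0 ≤ L := by positivity
  have hL2 : L ≤ 2 := by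
    rw [hL, div_le_iff₀ (by positivity)]
    linarith
  have hlog : L ≤ Real.log (1 + s) := Real.le_log_one_add_of_nonneg hs
  have hp : 1 + h * L ≤ (1 + s) ^ h := by
    rw [Real.rpow_def_of_pos (by linarith)]
    nlinarith [Real.add_one_le_exp (Real.log (1 + s) * h)]
  have hr : (1 + s) ^ (1 - h) ≤ (1 + s) * (1 - h * L / (1 + 2 * h)) := by
    rw [Real.rpow_sub (by linarith), Real.rpow_one, div_eq_mul_inv]
    gcongr
    calc ((1 + s) ^ h)⁻¹ ≤ (1 + h * L)⁻¹ := by gcongr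
      _ = 1 - h * L / (1 + h * L) := by field_simp; ring
      _ ≤ _ := by
        have : h * L ≤ 2 * h := by nlinarith
        gcongr
  calc _ ≤ h / (1 + 2 * h) * ((1 + s) / (2 + s) * L) := by
        rw [add_sub_cancel_left]
        exact mul_le_mul_of_nonneg_left (linear_mul_le_log_bound hs) (by positivity)
    _ = (1 + s) * (h * L / (1 + 2 * h)) / (1 + s + 1) := by
        rw [show 1 + s + 1 = 2 + s by ring]
        field_simp
    _ ≤ _ := by
        gcongr
        linarith

theorem hasDerivAt_exp_neg_mul_quadratic (t : ℝ) :
    HasDerivAt (fun t : ℝ =>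
      -(Real.exp (-t) * (37 / 100 + 37 / 100 * (t - 1) - 3 / 50 * (t - 1) ^ 2)))
      (Real.exp (-t) * ((t - 1) * (49 / 100 - 3 / 50 * (t - 1)))) t := by
  have h1 : HasDerivAt (fun t : ℝ => t - 1) 1 t := (hasDerivAt_id t).sub_const 1
  have h2 : HasDerivAt (fun t : ℝ => Real.exp (-t)) (Real.exp (-t) * -1) t :=
    (hasDerivAt_neg t).exp
  refine (h2.mul (((h1.const_mul (37 / 100)).const_add (37 / 100)).sub
    ((h1.pow 2).const_mul (3 / 50)))).neg.congr_deriv ?_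
  simp only [Pi.sub_apply, Pi.pow_apply]
  ring

theorem integrableOn_exp_neg_mul_quadratic :
    IntegrableOn (fun t : ℝ => Real.exp (-t) * ((t - 1) * (49 / 100 - 3 / 50 * (t - 1))))
      (Set.Ioi 1) := by
  have e0 : IntegrableOn (fun t : ℝ => Real.exp (-t)) (Set.Ioi 0) := integrableOn_exp_neg_Ioi 0
  have e2 : IntegrableOn (fun t : ℝ => Real.exp (-t) * t ^ 2) (Set.Ioi 0) := by
    have := Real.GammaIntegral_convergent (s := 3) (by norm_num)
    rw [show (3 : ℝ) - 1 = (2 : ℕ) by norm_num] at this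
    simpa only [Real.rpow_natCast] using this
  refine IntegrableOn.mono_set ?_ (Set.Ioi_subset_Ioi zero_le_one)
  refine (((e0.const_mul (-(55 / 100))).add
    (integrableOn_exp_neg_mul.const_mul (61 / 100))).sub
    (e2.const_mul (3 / 50))).congr (Filter.Eventually.of_forall fun t => ?_)
  simp only [Pi.add_apply, Pi.sub_apply]
  ring

theorem integral_exp_neg_mul_quadratic :
    ∫ t in Set.Ioi (1 : ℝ), Real.exp (-t) * ((t - 1) * (49 / 100 - 3 / 50 * (t - 1))) =
      37 / 100 * Real.exp (-1) := by
  have hlim : Filter.Tendsto (fun t : ℝ =>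
      -(Real.exp (-t) * (37 / 100 + 37 / 100 * (t - 1) - 3 / 50 * (t - 1) ^ 2)))
      Filter.atTop (nhds 0) := by
    have h0 := Real.tendsto_pow_mul_exp_neg_atTop_nhds_zero 0
    have h1 := Real.tendsto_pow_mul_exp_neg_atTop_nhds_zero 1
    have h2 := Real.tendsto_pow_mul_exp_neg_atTop_nhds_zero 2
    have := ((h0.const_mul (3 / 50)).add (h1.const_mul (-(49 / 100)))).add (h2.const_mul (3 / 50))
    simp only [mul_zero, add_zero] at this
    refine this.congr fun t => ?_
    ring
  rw [integral_Ioi_of_hasDerivAt_of_tendsto' (fun t _ => hasDerivAt_exp_neg_mul_quadratic t)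
    integrableOn_exp_neg_mul_quadratic hlim]
  norm_num
  ring

theorem integral_quadratic_mul_sub_rpow {h : ℝ} (hh : h < 1) :
    ∫ t in (0 : ℝ)..1, (1 - 8 / 5 * t + 87 / 100 * t ^ 2) * (t - t ^ (1 - h)) =
      -h * (1 / (2 * (2 - h)) - 8 / 5 / (3 * (3 - h)) + 87 / 100 / (4 * (4 - h))) := by
  have hp : ∀ p : ℝ, 0 < p → ∫ t in (0 : ℝ)..1, t ^ p = 1 / (p + 1) := fun p hp => by
    rw [integral_rpow (Or.inl (by linarith)), Real.one_rpow, Real.zero_rpow (by linarith),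
      sub_zero]
  have hI : ∀ p : ℝ, 0 < p → IntervalIntegrable (fun t : ℝ => t ^ p) volume 0 1 :=
    fun p hp => intervalIntegral.intervalIntegrable_rpow' (by linarith)
  have hterm : ∀ p : ℝ, 1 ≤ p → ∫ t in (0 : ℝ)..1, (t ^ p - t ^ (p - h)) =
      -h * (1 / ((p + 1) * (p + 1 - h))) := fun p h1 => by
    rw [intervalIntegral.integral_sub (hI p (by linarith)) (hI _ (by linarith)),
      hp p (by linarith), hp _ (by linarith)]
    have : p + 1 ≠ 0 := by linarith
    have : p + 1 - h ≠ 0 := by linarith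
    have : p - h + 1 ≠ 0 := by linarith
    field_simp
    ring
  have hint : ∀ p : ℝ, 1 ≤ p →
      IntervalIntegrable (fun t : ℝ => t ^ p - t ^ (p - h)) volume 0 1 :=
    fun p h1 => (hI p (by linarith)).sub (hI _ (by linarith))
  have hcongr : ∫ t in (0 : ℝ)..1, (1 - 8 / 5 * t + 87 / 100 * t ^ 2) * (t - t ^ (1 - h)) =
      ∫ t in (0 : ℝ)..1, ((t ^ (1 : ℝ) - t ^ (1 - h)) - 8 / 5 * (t ^ (2 : ℝ) - t ^ (2 - h)) +
        87 / 100 * (t ^ (3 : ℝ) - t ^ (3 - h))) := by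
    rw [intervalIntegral.integral_of_le zero_le_one, intervalIntegral.integral_of_le zero_le_one]
    refine setIntegral_congr_fun measurableSet_Ioc fun t ht => ?_
    have h2 : t ^ (2 - h) = t * t ^ (1 - h) := by
      rw [show 2 - h = 1 + (1 - h) by ring, Real.rpow_add ht.1, Real.rpow_one]
    have h3 : t ^ (3 - h) = t ^ 2 * t ^ (1 - h) := by
      rw [show 3 - h = (2 : ℕ) + (1 - h) by push_cast; ring, Real.rpow_add ht.1,
        Real.rpow_natCast]
    have h3' : t ^ (3 : ℝ) = t ^ 3 := by exact_mod_cast Real.rpow_natCast t 3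
    simp only [h2, h3, h3', Real.rpow_one, Real.rpow_two]
    ring
  rw [hcongr, intervalIntegral.integral_add
    ((hint 1 le_rfl).sub ((hint 2 (by norm_num)).const_mul _))
    ((hint 3 (by norm_num)).const_mul _),
    intervalIntegral.integral_sub (hint 1 le_rfl) ((hint 2 (by norm_num)).const_mul _),
    intervalIntegral.integral_const_mul, intervalIntegral.integral_const_mul,
    hterm 1 le_rfl, hterm 2 (by norm_num), hterm 3 (by norm_num)]
  have : 2 - h ≠ 0 := by linarith
  have : 3 - h ≠ 0 := by linarith
  have : 4 - h ≠ 0 := by linarith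
  rw [show 1 + 1 - h = 2 - h by ring, show 2 + 1 - h = 3 - h by ring,
    show 3 + 1 - h = 4 - h by ring]
  field_simp
  ring

theorem altGamma_sub_le {h : ℝ} (h0 : 0 < h) (h1 : h < 1) :
    h * (37 / 100 * Real.exp (-1) / (1 + 2 * h) -
      (1 / (2 * (2 - h)) - 8 / 5 / (3 * (3 - h)) + 87 / 100 / (4 * (4 - h)))) ≤
    altGamma 0 - altGamma (-h) := by
  have hi : IntegrableOn (fun t : ℝ =>
      Real.exp (-t) * t / (t + 1) - Real.exp (-t) * t ^ (-h + 1) / (t + 1)) (Set.Ioi 0) :=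
    integrableOn_altGamma_zero.sub (integrableOn_altGamma (by linarith))
  have hs : altGamma 0 - altGamma (-h) = ∫ t in Set.Ioi (0 : ℝ),
      (Real.exp (-t) * t / (t + 1) - Real.exp (-t) * t ^ (-h + 1) / (t + 1)) := by
    rw [integral_sub integrableOn_altGamma_zero (integrableOn_altGamma (by linarith)),
      ← altGamma_zero]
    rfl
  have hform : ∀ t : ℝ,
      Real.exp (-t) * t / (t + 1) - Real.exp (-t) * t ^ (-h + 1) / (t + 1) =
        Real.exp (-t) * ((t - t ^ (1 - h)) / (t + 1)) := fun t => by
    rw [neg_add_eq_sub]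
    ring
  rw [hs, ← Set.Ioc_union_Ioi_eq_Ioi zero_le_one, setIntegral_union
    (Set.Ioc_disjoint_Ioi le_rfl) measurableSet_Ioi
    (hi.mono_set Set.Ioc_subset_Ioi_self) (hi.mono_set (Set.Ioi_subset_Ioi zero_le_one))]
  have hupper : h / (1 + 2 * h) * (37 / 100 * Real.exp (-1)) ≤ ∫ t in Set.Ioi (1 : ℝ),
      (Real.exp (-t) * t / (t + 1) - Real.exp (-t) * t ^ (-h + 1) / (t + 1)) := by
    rw [← integral_exp_neg_mul_quadratic, ← integral_const_mul]
    refine setIntegral_mono_on (integrableOn_exp_neg_mul_quadratic.const_mul _)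
      (hi.mono_set (Set.Ioi_subset_Ioi zero_le_one)) measurableSet_Ioi fun t (ht : 1 < t) => ?_
    rw [hform, mul_left_comm]
    gcongr
    exact le_sub_rpow_of_one_le h0 ht.le
  have hlower : -h * (1 / (2 * (2 - h)) - 8 / 5 / (3 * (3 - h)) + 87 / 100 / (4 * (4 - h))) ≤
      ∫ t in Set.Ioc (0 : ℝ) 1,
      (Real.exp (-t) * t / (t + 1) - Real.exp (-t) * t ^ (-h + 1) / (t + 1)) := by
    rw [← integral_quadratic_mul_sub_rpow h1, intervalIntegral.integral_of_le zero_le_one]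
    refine setIntegral_mono_on ?_ (hi.mono_set Set.Ioc_subset_Ioi_self) measurableSet_Ioc
      fun t ht => ?_
    · rw [← intervalIntegrable_iff_integrableOn_Ioc_of_le zero_le_one]
      refine Continuous.intervalIntegrable ?_ _ _
      have := Real.continuous_rpow_const (q := 1 - h) (by linarith)
      fun_prop
    · have hle : t - t ^ (1 - h) ≤ 0 := by
        have := Real.rpow_le_rpow_of_exponent_ge ht.1 ht.2 (show 1 - h ≤ 1 by linarith)
        rw [Real.rpow_one] at this
        linarith
      have := mul_le_mul_of_nonpos_right (exp_neg_div_le_quadratic ht.1.le ht.2) hle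
      rw [hform]
      refine this.trans_eq ?_
      ring
  refine le_trans (le_of_eq ?_) (add_le_add hlower hupper)
  ring

theorem altGamma_lt_altGamma_zero_mul_cos :
    altGamma (-(1 / 1000)) < Real.cos (Real.pi * -(1 / 1000)) * altGamma 0 := by
  have h := altGamma_sub_le (h := 1 / 1000) (by norm_num) (by norm_num)
  have he : (0.3678 : ℝ) < Real.exp (-1) := by
    have := Real.exp_neg_one_gt_d9
    linarith
  have hc : 1 - (Real.pi * -(1 / 1000)) ^ 2 / 2 ≤ Real.cos (Real.pi * -(1 / 1000)) :=
    Real.one_sub_sq_div_two_le_cos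
  have hpi : Real.pi ^ 2 < 10 := by nlinarith [Real.pi_lt_d2, Real.pi_pos]
  have hC : altGamma 0 ≤ 1 / 2 := by
    linarith [altGamma_zero_le_altGamma_neg_one, altGamma_neg_one_add_altGamma_zero]
  have hC0 : 0 < altGamma 0 := altGamma_pos (by norm_num)
  have hc' : 1 - Real.cos (Real.pi * -(1 / 1000)) ≤ 5 / 1000000 := by nlinarith
  have : (1 - Real.cos (Real.pi * -(1 / 1000))) * altGamma 0 ≤ 5 / 1000000 * (1 / 2) :=
    mul_le_mul hc' hC hC0.le (by norm_num)
  norm_num at h this ⊢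
  linarith

theorem reAltKurepa_pos_of_pos {x : ℝ} (hx : 0 < x) : 0 < reAltKurepa x := by
  rw [reAltKurepa_eq (by linarith)]
  have hC0 : 0 < altGamma 0 := altGamma_pos (by norm_num)
  have h0 : altGamma (-(1 / 1000)) < altGamma 0 :=
    altGamma_lt_altGamma_zero_mul_cos.trans_le
      (mul_le_of_le_one_left hC0.le (Real.cos_le_one _))
  have h := convexOn_altGamma.lt_right_of_left_lt (x := -(1 / 1000)) (y := x) (z := 0)
    (by norm_num) (by simp only [Set.mem_Ioi]; linarith)
    (by rw [openSegment_eq_Ioo (by linarith)]; exact ⟨by norm_num, hx⟩) h0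
  linarith [mul_le_of_le_one_left hC0.le (Real.cos_le_one (Real.pi * x))]

theorem reAltKurepa_pos_of_le_neg_half {x : ℝ} (h2 : -2 < x) (hx : x ≤ -(1 / 2)) :
    0 < reAltKurepa x := by
  rw [reAltKurepa_eq h2]
  have hC0 : 0 < altGamma 0 := altGamma_pos (by norm_num)
  have hpi := Real.pi_pos
  rcases le_or_gt (-(3 / 2)) x with h3 | h3
  · have hcos : Real.cos (Real.pi * x) ≤ 0 := by
      rw [← Real.cos_neg]
      exact Real.cos_nonpos_of_pi_div_two_le_of_le (by nlinarith) (by nlinarith)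
    nlinarith [altGamma_pos h2]
  · have hcos : Real.cos (Real.pi * x) < 1 := by
      rw [← Real.cos_add_two_pi, ← Real.cos_zero]
      exact Real.cos_lt_cos_of_nonneg_of_le_pi le_rfl (by nlinarith) (by nlinarith)
    have hG : altGamma (-1) ≤ altGamma x := by
      refine convexOn_altGamma.le_left_of_right_le (x := x) (y := 0) (z := -1) h2
        (by norm_num) ?_ altGamma_zero_le_altGamma_neg_one
      rw [openSegment_eq_Ioo (by linarith)]
      exact ⟨by linarith, by norm_num⟩
    nlinarith [altGamma_zero_le_altGamma_neg_one]

theorem strictConvexOn_reAltKurepa :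
    StrictConvexOn ℝ (Set.Icc (-(1 / 2)) 0) reAltKurepa := by
  have hC0 : 0 < altGamma 0 := altGamma_pos (by norm_num)
  refine ⟨convex_Icc _ _, fun x hx y hy hxy a b ha hb hab => ?_⟩
  have hz := (convex_Icc (-(1 / 2) : ℝ) 0) hx hy ha.le hb.le hab
  have mem : ∀ {u : ℝ}, u ∈ Set.Icc (-(1 / 2) : ℝ) 0 → -2 < u := fun hu => by linarith [hu.1]
  have memc : ∀ {u : ℝ}, u ∈ Set.Icc (-(1 / 2) : ℝ) 0 →
      Real.pi * u ∈ Set.Icc (-(Real.pi / 2)) (Real.pi / 2) := fun hu =>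
    ⟨by nlinarith [hu.1, Real.pi_pos], by nlinarith [hu.2, Real.pi_pos]⟩
  have h1 := convexOn_altGamma.2 (mem hx) (mem hy) ha.le hb.le hab
  have h2 := strictConcaveOn_cos_Icc.2 (memc hx) (memc hy)
    (fun h => hxy (mul_left_cancel₀ Real.pi_ne_zero h)) ha hb hab
  rw [reAltKurepa_eq (mem hx), reAltKurepa_eq (mem hy), reAltKurepa_eq (mem hz)]
  simp only [smul_eq_mul] at *
  rw [show a * (Real.pi * x) + b * (Real.pi * y) = Real.pi * (a * x + b * y) by ring] at h2
  nlinarith [mul_lt_mul_of_pos_right h2 hC0]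

theorem continuousOn_reAltKurepa : ContinuousOn reAltKurepa (Set.Ioi (-2)) := by
  have h : ContinuousOn (fun x => altGamma x - Real.cos (Real.pi * x) * altGamma 0)
      (Set.Ioi (-2)) :=
    (convexOn_altGamma.continuousOn isOpen_Ioi).sub (by fun_prop)
  exact h.congr fun x hx => reAltKurepa_eq hx

theorem reAltKurepa_zero : reAltKurepa 0 = 0 := by
  rw [reAltKurepa_eq (by norm_num)]
  simp

/-- `F(0) = 0`; there is a unique `x₁ ∈ (−2, 0)` with `F(x₁) = 0`; moreover `F > 0` on
`(−2, x₁) ∪ (0, ∞)` and `F < 0` on `(x₁, 0)`. -/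
theorem reAltKurepa_sign :
    reAltKurepa 0 = 0 ∧
    ∃ x₁ ∈ Set.Ioo (-2 : ℝ) 0, reAltKurepa x₁ = 0 ∧
      (∀ y ∈ Set.Ioo (-2 : ℝ) 0, reAltKurepa y = 0 → y = x₁) ∧
      (∀ x, x ∈ Set.Ioo (-2 : ℝ) x₁ ∪ Set.Ioi (0 : ℝ) → 0 < reAltKurepa x) ∧
      (∀ x ∈ Set.Ioo x₁ (0 : ℝ), reAltKurepa x < 0) := by
  refine ⟨reAltKurepa_zero, ?_⟩
  have hneg : reAltKurepa (-(1 / 1000)) < 0 := by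
    rw [reAltKurepa_eq (by norm_num)]
    exact sub_neg.mpr altGamma_lt_altGamma_zero_mul_cos
  have hhalf : 0 < reAltKurepa (-(1 / 2)) :=
    reAltKurepa_pos_of_le_neg_half (by norm_num) le_rfl
  have hcont : ContinuousOn reAltKurepa (Set.Icc (-(1 / 2)) (-(1 / 1000))) :=
    continuousOn_reAltKurepa.mono fun x hx => by
      simp only [Set.mem_Ioi]
      linarith [hx.1]
  obtain ⟨x₁, hx₁, hz⟩ := intermediate_value_Ioo' (by norm_num) hcont ⟨hneg, hhalf⟩
  have hx₁0 : x₁ < 0 := by linarith [hx₁.2]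
  have hlt : ∀ x ∈ Set.Ioo x₁ (0 : ℝ), reAltKurepa x < 0 := fun x hx => by
    have := strictConvexOn_reAltKurepa.lt_on_openSegment (x := x₁) (y := 0) (z := x)
      ⟨hx₁.1.le, hx₁0.le⟩ ⟨by norm_num, le_rfl⟩ hx₁0.ne
      (by rwa [openSegment_eq_Ioo hx₁0])
    simpa [hz, reAltKurepa_zero] using this
  have hgt : ∀ x ∈ Set.Ioo (-2 : ℝ) x₁, 0 < reAltKurepa x := fun x hx => by
    rcases le_or_gt x (-(1 / 2)) with h | h
    · exact reAltKurepa_pos_of_le_neg_half hx.1 h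
    · by_contra! hle
      have := strictConvexOn_reAltKurepa.lt_on_openSegment (x := x) (y := 0) (z := x₁)
        ⟨h.le, (hx.2.trans hx₁0).le⟩ ⟨by norm_num, le_rfl⟩ (hx.2.trans hx₁0).ne
        (by rw [openSegment_eq_Ioo (hx.2.trans hx₁0)]; exact ⟨hx.2, hx₁0⟩)
      rw [hz, reAltKurepa_zero, max_eq_right hle] at this
      exact this.false
  refine ⟨x₁, ⟨by linarith [hx₁.1], hx₁0⟩, hz, fun y hy hy0 => ?_, ?_, hlt⟩
  · rcases lt_trichotomy y x₁ with h | h | h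
    · exact absurd hy0 (hgt y ⟨hy.1, h⟩).ne'
    · exact h
    · exact absurd hy0 (hlt y ⟨h, hy.2⟩).ne
  · rintro x (hx | hx)
    · exact hgt x hx
    · exact reAltKurepa_pos_of_pos hx
end
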